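/- arXiv:1204.2290 — 2 statements merged into one kernel-verified Lean document; each statement's English description precedes it below -/
import Mathlib

section
/- For every s ≥ 1, one has σ_{4s} ≤ √2 · γ^{−1} · √(σ_{2s} · d_s). -/
open Metric Submodule

open InnerProductSpace Module

/-- **Hadamard's inequality** for the determinant in an orthonormal basis. -/
lemma OrthonormalBasis.abs_det_le_prod_norm {E : Type*} [NormedAddCommGroup E]
    [InnerProductSpace ℝ E] {n : ℕ} (b : OrthonormalBasis (Fin n) ℝ E) (v : Fin n → E) :
    |b.toBasis.det v| ≤ ∏ i, ‖v i‖ := by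
  have : Fact (finrank ℝ E = n) := ⟨by simpa using finrank_eq_card_basis b.toBasis⟩
  rw [← b.toBasis.orientation.volumeForm_robust' b v]
  exact b.toBasis.orientation.abs_volumeForm_apply_le v

section Scaling

variable {E : Type*} [NormedAddCommGroup E] [InnerProductSpace ℝ E] [FiniteDimensional ℝ E]

/-- The map scaling `W` by `a` and its orthogonal complement by `b`. -/
noncomputable def Submodule.orthogonalScaling (W : Submodule ℝ E) (a b : ℝ) : E →ₗ[ℝ] E :=
  a • (W.starProjection : E →ₗ[ℝ] E) + b • (Wᗮ.starProjection : E →ₗ[ℝ] E)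

lemma Submodule.orthogonalScaling_apply (W : Submodule ℝ E) (a b : ℝ) (x : E) :
    W.orthogonalScaling a b x = a • W.starProjection x + b • Wᗮ.starProjection x := rfl

lemma Submodule.det_orthogonalScaling (W : Submodule ℝ E) (a b : ℝ) :
    LinearMap.det (W.orthogonalScaling a b) = a ^ finrank ℝ W * b ^ finrank ℝ Wᗮ := by
  let e := W.prodEquivOfIsCompl Wᗮ W.isCompl_orthogonal
  let D : (W × Wᗮ) →ₗ[ℝ] (W × Wᗮ) :=
    LinearMap.prodMap (a • LinearMap.id) (b • LinearMap.id)
  have hconj : W.orthogonalScaling a b = e ∘ₗ D ∘ₗ e.symm := by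
    ext x
    obtain ⟨⟨w, w'⟩, rfl⟩ := e.surjective x
    have h1 : W.starProjection (w : E) = w := starProjection_eq_self_iff.2 w.2
    have h2 : W.starProjection (w' : E) = 0 := W.starProjection_apply_eq_zero_iff.2 w'.2
    simp [e, D, orthogonalScaling_apply, starProjection_orthogonal_val, h1, h2]
  rw [hconj, LinearMap.det_conj, LinearMap.det_prodMap]
  simp [LinearMap.det_smul]

lemma Submodule.norm_starProjection_orthogonal_le_infDist (W : Submodule ℝ E) (x : E) :
    ‖Wᗮ.starProjection x‖ ≤ infDist x (W : Set E) := by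
  refine (le_infDist ⟨0, W.zero_mem⟩).2 fun y hy => ?_
  have hy0 : Wᗮ.starProjection y = 0 :=
    starProjection_orthogonal_apply_eq_zero hy
  rw [dist_eq_norm, ← sub_zero (Wᗮ.starProjection x), ← hy0, ← map_sub]
  exact norm_starProjection_apply_le _ _

lemma Submodule.norm_orthogonalScaling_sq_le (W : Submodule ℝ E) {r δ : ℝ} {x : E}
    (hx : ‖x‖ ≤ r) (hxW : infDist x (W : Set E) ≤ δ) :
    ‖W.orthogonalScaling δ r x‖ ^ 2 ≤ 2 * (r * δ) ^ 2 := by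
  have hp : ‖W.starProjection x‖ ≤ r := (norm_starProjection_apply_le _ _).trans hx
  have hq : ‖Wᗮ.starProjection x‖ ≤ δ :=
    (W.norm_starProjection_orthogonal_le_infDist x).trans hxW
  have horth : inner ℝ (δ • W.starProjection x) (r • Wᗮ.starProjection x) = 0 :=
    (mem_orthogonal W _).1 (Wᗮ.smul_mem r (starProjection_apply_mem _ _)) _
      (W.smul_mem δ (starProjection_apply_mem _ _))
  have hadd := norm_add_sq_eq_norm_sq_add_norm_sq_of_inner_eq_zero _ _ horth
  rw [orthogonalScaling_apply, sq, hadd, norm_smul, norm_smul]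
  have h1 : ‖W.starProjection x‖ ^ 2 ≤ r ^ 2 := by gcongr
  have h2 : ‖Wᗮ.starProjection x‖ ^ 2 ≤ δ ^ 2 := by gcongr
  have h3 := sq_abs δ
  have h4 := sq_abs r
  simp only [Real.norm_eq_abs]
  nlinarith [mul_le_mul_of_nonneg_left h1 (sq_nonneg δ),
    mul_le_mul_of_nonneg_left h2 (sq_nonneg r)]

/-- A determinant of `2m` vectors of norm at most `r` that all lie within `δ` of a subspace of
dimension at most `m` is at most `(2rδ)^m`. -/
lemma OrthonormalBasis.abs_det_le_of_infDist_le {m : ℕ}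
    (b : OrthonormalBasis (Fin (2 * m)) ℝ E) (v : Fin (2 * m) → E) (W : Submodule ℝ E)
    (hW : finrank ℝ W ≤ m) {r δ : ℝ} (hδ : 0 < δ) (hδr : δ ≤ r)
    (hv : ∀ i, ‖v i‖ ≤ r) (hvW : ∀ i, infDist (v i) (W : Set E) ≤ δ) :
    |b.toBasis.det v| ≤ (2 * r * δ) ^ m := by
  have hr : 0 < r := hδ.trans_le hδr
  have hdim : finrank ℝ W + finrank ℝ Wᗮ = 2 * m := by
    rw [W.finrank_add_finrank_orthogonal]
    simpa using finrank_eq_card_basis b.toBasis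
  have hnorm : ∀ i, ‖W.orthogonalScaling δ r (v i)‖ ≤ √2 * (r * δ) := fun i => by
    refine le_of_sq_le_sq ?_ (by positivity)
    rw [mul_pow, Real.sq_sqrt (by norm_num)]
    exact W.norm_orthogonalScaling_sq_le (hv i) (hvW i)
  have hhad : |b.toBasis.det (W.orthogonalScaling δ r ∘ v)| ≤ (√2 * (r * δ)) ^ (2 * m) :=
    (b.abs_det_le_prod_norm _).trans <| by
      simpa using Finset.prod_le_prod (s := Finset.univ) (fun i _ => norm_nonneg _)
        fun i _ => hnorm i
  rw [Basis.det_comp, abs_mul, W.det_orthogonalScaling, abs_of_pos (by positivity), pow_mul,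
    mul_pow, Real.sq_sqrt (by norm_num)] at hhad
  have hscale : (r * δ) ^ m ≤ δ ^ finrank ℝ W * r ^ finrank ℝ Wᗮ := by
    obtain ⟨k, hk⟩ := Nat.exists_eq_add_of_le hW
    have hk' : finrank ℝ Wᗮ = m + k := by omega
    rw [hk', mul_pow, pow_add]
    nth_rw 2 [hk]
    rw [pow_add]
    calc r ^ m * (δ ^ finrank ℝ W * δ ^ k) ≤ r ^ m * (δ ^ finrank ℝ W * r ^ k) := by gcongr
      _ = _ := by ring
  have hpos : 0 < (r * δ) ^ m := by positivity
  refine le_of_mul_le_mul_left ?_ hpos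
  calc (r * δ) ^ m * |b.toBasis.det v|
      ≤ δ ^ finrank ℝ W * r ^ finrank ℝ Wᗮ * |b.toBasis.det v| := by gcongr
    _ ≤ (2 * (r * δ) ^ 2) ^ m := hhad
    _ = (r * δ) ^ m * (2 * r * δ) ^ m := by rw [← mul_pow]; ring

end Scaling

section GramSchmidt

variable {H : Type*} [NormedAddCommGroup H] [InnerProductSpace ℝ H]

lemma infDist_span_le_norm_gramSchmidt (f : ℕ → H) (n : ℕ) :
    infDist (f n) (span ℝ (f '' Set.Iio n) : Set H) ≤ ‖gramSchmidt ℝ f n‖ := by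
  have hmem : f n - gramSchmidt ℝ f n ∈ span ℝ (f '' Set.Iio n) := by
    rw [← span_gramSchmidt_Iio ℝ f n, gramSchmidt_def, sub_sub_cancel]
    refine sum_mem fun i hi => ?_
    rw [starProjection_singleton]
    exact smul_mem _ _ (subset_span ⟨i, by simpa using hi, rfl⟩)
  simpa [dist_eq_norm] using infDist_le_dist_of_mem (x := f n) hmem

lemma inner_gramSchmidt_self (f : ℕ → H) (n : ℕ) :
    inner ℝ (gramSchmidt ℝ f n) (f n) = ‖gramSchmidt ℝ f n‖ ^ 2 := by
  conv_lhs => rw [gramSchmidt_def' ℝ f n]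
  rw [inner_add_right, inner_sum, Finset.sum_eq_zero, add_zero, real_inner_self_eq_norm_sq]
  intro i hi
  rw [starProjection_singleton, inner_smul_right,
    gramSchmidt_orthogonal ℝ f (Finset.mem_Iio.1 hi).ne', mul_zero]

end GramSchmidt

section Coordinates

variable {H : Type*} [NormedAddCommGroup H] [InnerProductSpace ℝ H] {ι : Type*}

/-- The coordinates of a vector along a finite family. -/
noncomputable def innerCoords (e : ι → H) : H →ₗ[ℝ] EuclideanSpace ℝ ι :=
  (WithLp.linearEquiv 2 ℝ (ι → ℝ)).symm.toLinearMap ∘ₗ LinearMap.pi fun i => innerₗ H (e i)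

@[simp] lemma innerCoords_apply (e : ι → H) (x : H) (i : ι) :
    innerCoords e x i = inner ℝ (e i) x := rfl

variable [Fintype ι]

lemma norm_innerCoords_le {e : ι → H} (he : Orthonormal ℝ e) (x : H) :
    ‖innerCoords e x‖ ≤ ‖x‖ := by
  refine le_of_sq_le_sq ?_ (norm_nonneg _)
  rw [EuclideanSpace.norm_sq_eq]
  exact he.sum_inner_products_le x

lemma infDist_innerCoords_map_le {e : ι → H} (he : Orthonormal ℝ e) (Y : Submodule ℝ H) (x : H) :
    infDist (innerCoords e x) (Y.map (innerCoords e) : Set (EuclideanSpace ℝ ι)) ≤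
      infDist x (Y : Set H) := by
  refine (le_infDist ⟨0, Y.zero_mem⟩).2 fun y hy => ?_
  refine (infDist_le_dist_of_mem (mem_map_of_mem hy)).trans ?_
  rw [dist_eq_norm, dist_eq_norm, ← map_sub]
  exact norm_innerCoords_le he _

lemma norm_innerCoords_le_infDist {e : ι → H} (he : Orthonormal ℝ e) (V : Submodule ℝ H)
    (hV : ∀ y ∈ V, ∀ i, inner ℝ (e i) y = 0) (x : H) :
    ‖innerCoords e x‖ ≤ infDist x (V : Set H) := by
  refine (le_infDist ⟨0, V.zero_mem⟩).2 fun y hy => ?_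
  have hy0 : innerCoords e y = 0 := by ext i; simp [hV y hy i]
  rw [dist_eq_norm, ← sub_zero (innerCoords e x), ← hy0, ← map_sub]
  exact norm_innerCoords_le he _

end Coordinates

/-- The determinant estimate behind the greedy recursion: the Gram-Schmidt norms of
`f N, …, f (N + 2m - 1)`. -/
lemma prod_norm_gramSchmidt_le {H : Type*} [NormedAddCommGroup H] [InnerProductSpace ℝ H]
    (f : ℕ → H) (N m : ℕ) (hne : ∀ i < 2 * m, gramSchmidt ℝ f (N + i) ≠ 0)
    (Y : Submodule ℝ H) [FiniteDimensional ℝ Y] (hY : finrank ℝ Y ≤ m) {r δ : ℝ}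
    (hδ : 0 < δ) (hδr : δ ≤ r)
    (hr : ∀ n, infDist (f n) (span ℝ (f '' Set.Iio N) : Set H) ≤ r)
    (hfY : ∀ n, infDist (f n) (Y : Set H) ≤ δ) :
    ∏ i : Fin (2 * m), ‖gramSchmidt ℝ f (N + i)‖ ≤ (2 * r * δ) ^ m := by
  let e : Fin (2 * m) → H := fun i => gramSchmidtNormed ℝ f (N + i)
  have he_def : ∀ i, e i = ‖gramSchmidt ℝ f (N + i)‖⁻¹ • gramSchmidt ℝ f (N + i) :=
    fun i => rfl
  have he : Orthonormal ℝ e := by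
    refine ⟨fun i => ?_, fun i j hij => ?_⟩
    · rw [he_def, norm_smul, norm_inv, norm_norm,
        inv_mul_cancel₀ (norm_ne_zero_iff.2 (hne i i.2))]
    · change inner ℝ (e i) (e j) = 0
      rw [he_def, he_def, inner_smul_left, inner_smul_right, gramSchmidt_orthogonal, mul_zero,
        mul_zero]
      simpa [Fin.val_inj] using hij
  let v : Fin (2 * m) → EuclideanSpace ℝ (Fin (2 * m)) := fun i => innerCoords e (f (N + i))
  let b := EuclideanSpace.basisFun (Fin (2 * m)) ℝ
  have hinv : ∀ (i : Fin (2 * m)) (n : ℕ), n < N + i → inner ℝ (e i) (f n) = 0 := fun i n hn => by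
    rw [he_def, inner_smul_left, gramSchmidt_inv_triangular ℝ f hn, mul_zero]
  have hV : ∀ y ∈ span ℝ (f '' Set.Iio N), ∀ i, inner ℝ (e i) y = 0 := fun y hy i => by
    refine (mem_orthogonal_singleton_iff_inner_right (𝕜 := ℝ)).1
      ((span_le (p := (ℝ ∙ e i)ᗮ)).2 ?_ hy)
    rintro _ ⟨n, hn, rfl⟩
    exact (mem_orthogonal_singleton_iff_inner_right (𝕜 := ℝ)).2
      (hinv i n (lt_of_lt_of_le hn (Nat.le_add_right _ _)))
  have hdet : b.toBasis.det v = ∏ i : Fin (2 * m), ‖gramSchmidt ℝ f (N + i)‖ := by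
    rw [Basis.det_apply, Matrix.det_of_isUpperTriangular]
    · refine Finset.prod_congr rfl fun i _ => ?_
      have : b.toBasis.toMatrix v i i = inner ℝ (e i) (f (N + i)) := by
        simp [Basis.toMatrix_apply, b, v]
      rw [this, he_def, inner_smul_left, inner_gramSchmidt_self]
      have := norm_ne_zero_iff.2 (hne i i.2)
      simp only [conj_trivial]
      field_simp
    · intro i j hij
      have : b.toBasis.toMatrix v i j = inner ℝ (e i) (f (N + j)) := by
        simp [Basis.toMatrix_apply, b, v]
      rw [this]
      exact hinv i _ (by simpa using hij)
  rw [← hdet]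
  exact (le_abs_self _).trans <| b.abs_det_le_of_infDist_le v (Y.map (innerCoords e))
    ((finrank_map_le _ _).trans hY) hδ hδr
    (fun i => (norm_innerCoords_le_infDist he _ hV _).trans (hr _))
    (fun i => (infDist_innerCoords_map_le he Y _).trans (hfY _))

lemma infDist_submodule_le_norm {H : Type*} [NormedAddCommGroup H] [InnerProductSpace ℝ H]
    (Y : Submodule ℝ H) (x : H) : infDist x (Y : Set H) ≤ ‖x‖ := by
  simpa using infDist_le_dist_of_mem (x := x) Y.zero_mem

/-- Inequality (3.9): `σ_{4s} ≤ √2 γ⁻¹ √(σ_{2s} d_s)`. -/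
theorem weak_greedy_hilbert_recursive
    {H : Type*} [NormedAddCommGroup H] [InnerProductSpace ℝ H] [CompleteSpace H]
    (γ : ℝ) (hγ0 : 0 < γ) (hγ1 : γ ≤ 1)
    (F : Set H) (hFc : IsCompact F) (hFb : ∀ g ∈ F, ‖g‖ ≤ 1)
    (f : ℕ → H) (hfF : ∀ n, f n ∈ F)
    (σ : ℕ → ℝ)
    (hσ : ∀ n, σ n =
      sSup ((fun g => infDist g ((span ℝ (f '' Set.Iio n) : Submodule ℝ H) : Set H)) '' F))
    (hgreedy : ∀ n, γ * σ n ≤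
      infDist (f n) ((span ℝ (f '' Set.Iio n) : Submodule ℝ H) : Set H))
    (d : ℕ → ℝ)
    (hd : ∀ m, d m =
      ⨅ Y : {Y : Submodule ℝ H // FiniteDimensional ℝ Y ∧ Module.finrank ℝ Y ≤ m},
        sSup ((fun g => infDist g ((Y : Submodule ℝ H) : Set H)) '' F))
    (s : ℕ) (hs : 1 ≤ s) :
    σ (4 * s) ≤ Real.sqrt 2 * γ⁻¹ * Real.sqrt (σ (2 * s) * d s) := by
  have hbdd : ∀ Y : Submodule ℝ H, BddAbove ((fun g => infDist g (Y : Set H)) '' F) := fun Y =>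
    ⟨1, by rintro _ ⟨g, hg, rfl⟩; exact (infDist_submodule_le_norm Y g).trans (hFb g hg)⟩
  have hle_sup : ∀ (Y : Submodule ℝ H), ∀ g ∈ F,
      infDist g (Y : Set H) ≤ sSup ((fun g => infDist g (Y : Set H)) '' F) :=
    fun Y g hg => le_csSup (hbdd Y) ⟨g, hg, rfl⟩
  have hσ0 : ∀ n, 0 ≤ σ n := fun n => by
    rw [hσ]; exact infDist_nonneg.trans (hle_sup _ _ (hfF 0))
  have hanti : Antitone σ := fun a c hac => by
    rw [hσ a, hσ c]
    refine csSup_le (Set.Nonempty.image _ ⟨_, hfF 0⟩) ?_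
    rintro _ ⟨g, hg, rfl⟩
    exact (infDist_le_infDist_of_subset
      (span_mono (Set.image_mono (Set.Iio_subset_Iio hac))) ⟨0, zero_mem _⟩).trans
      (hle_sup _ g hg)
  rcases (hσ0 (4 * s)).eq_or_lt with h0 | hpos
  · rw [← h0]; positivity
  have hpos2 : 0 < σ (2 * s) := hpos.trans_le (hanti (by omega))
  have hgs : ∀ n, γ * σ n ≤ ‖gramSchmidt ℝ f n‖ :=
    fun n => (hgreedy n).trans (infDist_span_le_norm_gramSchmidt f n)
  have hgs' : ∀ i < 2 * s, γ * σ (4 * s) ≤ ‖gramSchmidt ℝ f (2 * s + i)‖ := fun i hi =>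
    (mul_le_mul_of_nonneg_left (hanti (by omega)) hγ0.le).trans (hgs _)
  have key : ∀ (Y : Submodule ℝ H), FiniteDimensional ℝ Y → finrank ℝ Y ≤ s → ∀ δ : ℝ,
      sSup ((fun g => infDist g (Y : Set H)) '' F) < δ →
      (γ * σ (4 * s)) ^ 2 ≤ 2 * σ (2 * s) * δ := by
    intro Y hYf hY δ hδ
    have hδ0 : 0 < δ := (infDist_nonneg.trans (hle_sup Y _ (hfF 0))).trans_lt hδ
    rcases le_total δ (σ (2 * s)) with hle | hle
    · have hprod := prod_norm_gramSchmidt_le f (2 * s) s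
        (fun i hi => norm_pos_iff.1 ((mul_pos hγ0 hpos).trans_le (hgs' i hi))) Y hY hδ0 hle
        (fun n => by rw [hσ]; exact hle_sup _ _ (hfF n))
        (fun n => (hle_sup Y _ (hfF n)).trans hδ.le)
      have hlow : (γ * σ (4 * s)) ^ (2 * s) ≤
          ∏ i : Fin (2 * s), ‖gramSchmidt ℝ f (2 * s + i)‖ := by
        simpa using Finset.prod_le_prod (s := (Finset.univ : Finset (Fin (2 * s))))
          (fun i _ => (mul_pos hγ0 hpos).le) fun i _ => hgs' i i.2
      have := hlow.trans hprod
      rw [pow_mul] at this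
      exact le_of_pow_le_pow_left₀ (by omega) (by positivity) this
    · have h1 : γ * σ (4 * s) ≤ σ (2 * s) :=
        (mul_le_of_le_one_left hpos.le hγ1).trans (hanti (by omega))
      have h2 : (γ * σ (4 * s)) ^ 2 ≤ σ (2 * s) ^ 2 := by gcongr
      nlinarith [mul_le_mul_of_nonneg_left hle hpos2.le]
  have hdle : (γ * σ (4 * s)) ^ 2 / (2 * σ (2 * s)) ≤ d s := by
    rw [hd]
    have : Nonempty {Y : Submodule ℝ H // FiniteDimensional ℝ Y ∧ finrank ℝ Y ≤ s} :=
      ⟨⟨⊥, inferInstance, by simp⟩⟩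
    refine le_ciInf fun Y => le_of_forall_gt_imp_ge_of_dense fun δ hδ => ?_
    rw [div_le_iff₀' (by positivity)]
    exact key Y Y.2.1 Y.2.2 δ hδ
  rw [div_le_iff₀ (by positivity)] at hdle
  rw [mul_right_comm, ← Real.sqrt_mul (by norm_num), ← div_eq_mul_inv, le_div_iff₀ hγ0]
  refine Real.le_sqrt_of_sq_le ?_
  linarith
end

section
/- Let α > 0, C_0 > 0, and 0 < β < min{α, 1/2}. If d_n ≤ C_0 · n^{−α} for all n ≥ 1, then σ_n ≤ C_1 · n^{−α+1/2+β} for all n ≥ 1, where C_1 := max{ C_0 · 4^{4α+1} · γ^{−4} · ((2β+1)/(2β))^{α}, max_{1 ≤ n ≤ 7} n^{α−β−1/2} }. -/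
open Metric Submodule

/-- **Hadamard's inequality** for the columns of a real matrix. -/
lemma Matrix.det_sq_le_prod_sum_sq {n : ℕ} (M : Matrix (Fin n) (Fin n) ℝ) :
    M.det ^ 2 ≤ ∏ j, ∑ i, M i j ^ 2 := by
  have : Fact (Module.finrank ℝ (EuclideanSpace ℝ (Fin n)) = n) := ⟨by simp⟩
  let b := EuclideanSpace.basisFun (Fin n) ℝ
  let v : Fin n → EuclideanSpace ℝ (Fin n) := fun j => WithLp.toLp 2 fun i => M i j
  have h := b.toBasis.orientation.abs_volumeForm_apply_le v
  rw [Orientation.volumeForm_robust _ b rfl, Module.Basis.det_apply] at h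
  have hM : b.toBasis.toMatrix v = M := by
    ext i j
    simp [b, v, Module.Basis.toMatrix_apply]
  rw [hM] at h
  calc M.det ^ 2 = |M.det| ^ 2 := (sq_abs _).symm
    _ ≤ (∏ j, ‖v j‖) ^ 2 := by gcongr
    _ = ∏ j, ∑ i, M i j ^ 2 := by
      rw [← Finset.prod_pow]
      refine Finset.prod_congr rfl fun j _ => ?_
      simp [EuclideanSpace.norm_sq_eq, v]

/-- A subspace of dimension at most `m` is orthogonal to all but the first `m` vectors of some
orthonormal basis. -/
lemma exists_orthonormalBasis_inner_eq_zero {n m : ℕ}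
    (W : Submodule ℝ (EuclideanSpace ℝ (Fin n))) (hW : Module.finrank ℝ W ≤ m) :
    ∃ b : OrthonormalBasis (Fin n) ℝ (EuclideanSpace ℝ (Fin n)),
      ∀ w ∈ W, ∀ j : Fin n, m ≤ j → inner ℝ w (b j) = 0 := by
  classical
  let u := stdOrthonormalBasis ℝ W
  let v : Fin n → EuclideanSpace ℝ (Fin n) :=
    fun j => if h : (j : ℕ) < Module.finrank ℝ W then u ⟨j, h⟩ else 0
  have hWn : Module.finrank ℝ W ≤ n := by simpa using W.finrank_le
  have hv : Orthonormal ℝ ({j : Fin n | (j : ℕ) < Module.finrank ℝ W}.domRestrict v) := by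
    have : Orthonormal ℝ fun j => (u j : EuclideanSpace ℝ (Fin n)) :=
      u.orthonormal.comp_linearIsometry W.subtypeₗᵢ
    convert! this.comp
      (fun j : {j : Fin n | (j : ℕ) < Module.finrank ℝ W} => ⟨(j : Fin n), j.2⟩) ?_ using 1
    · ext1 j
      have := j.2
      simp only [Set.mem_ofPred_eq] at this
      simp [v, this]
    · intro i j hij
      simpa [Fin.ext_iff, Subtype.ext_iff] using hij
  obtain ⟨b, hb⟩ := hv.exists_orthonormalBasis_extension_of_card_eq (by simp)
  refine ⟨b, fun w hw j hj => ?_⟩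
  have hwsum : w = ∑ i, u.repr ⟨w, hw⟩ i • (u i : EuclideanSpace ℝ (Fin n)) := by
    simpa using (congrArg Subtype.val (u.sum_repr ⟨w, hw⟩)).symm
  rw [hwsum, sum_inner]
  refine Finset.sum_eq_zero fun i _ => ?_
  have hbi : b ⟨i, i.2.trans_le hWn⟩ = u i := by
    rw [hb _ i.2]
    simp [v]
  rw [inner_smul_left, ← hbi, b.inner_eq_zero, mul_zero]
  intro h
  have := i.2
  simp only [Fin.ext_iff] at h
  lia

/-- The **AM-GM inequality** in power form. -/
lemma prod_le_arith_mean_pow {n : ℕ} (hn : 0 < n) (z : Fin n → ℝ) (hz : ∀ i, 0 ≤ z i) :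
    ∏ i, z i ≤ ((∑ i, z i) / n) ^ n := by
  have h := Real.geom_mean_le_arith_mean Finset.univ (fun _ => 1) z (by simp) (by simpa) (by simpa)
  simp only [Real.rpow_one, Finset.sum_const, Finset.card_univ, Fintype.card_fin, nsmul_eq_mul,
    mul_one, one_mul] at h
  have h0 : 0 ≤ ∏ i, z i := Finset.prod_nonneg fun i _ => hz i
  calc ∏ i, z i = ((∏ i, z i) ^ (n : ℝ)⁻¹) ^ n := (Real.rpow_inv_natCast_pow h0 hn.ne').symm
    _ ≤ _ := by gcongr

/-- A norming functional for the distance to a subspace. -/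
lemma exists_linearMap_eq_infDist {X : Type*} [NormedAddCommGroup X] [NormedSpace ℝ X]
    (V : Submodule ℝ X) (x : X) :
    ∃ l : X →ₗ[ℝ] ℝ, l x = infDist x (V : Set X) ∧ ∀ y, |l y| ≤ infDist y (V : Set X) := by
  obtain ⟨g, hg, hgx⟩ := exists_dual_vector'' ℝ (V.mkQ x)
  have hnorm (y : X) : ‖V.mkQ y‖ = infDist y (V : Set X) :=
    QuotientAddGroup.norm_mk (S := V.toAddSubgroup) y
  refine ⟨g.toLinearMap ∘ₗ V.mkQ, ?_, fun y => ?_⟩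
  · rw [← hnorm x]; exact hgx
  · rw [← hnorm y]; exact g.le_of_opNorm_le_of_le hg le_rfl |>.trans_eq (one_mul _)

/-- A real square matrix whose rows are close to an `m`-dimensional subspace has small
determinant. -/
lemma Matrix.det_sq_le_of_rows_near_subspace {n m : ℕ} (hn : 0 < n) (hmn : m ≤ n)
    (G : Matrix (Fin n) (Fin n) ℝ) (W : Submodule ℝ (EuclideanSpace ℝ (Fin n)))
    (hW : Module.finrank ℝ W ≤ m) (h : Fin n → EuclideanSpace ℝ (Fin n)) (hh : ∀ i, h i ∈ W)
    {a b : ℝ} (ha : 0 < a) (hb : 0 < b)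
    (hGa : ∑ i, ‖WithLp.toLp 2 (G i)‖ ^ 2 ≤ a)
    (hGb : ∑ i, ‖WithLp.toLp 2 (G i) - h i‖ ^ 2 ≤ b) :
    G.det ^ 2 ≤ (2 / n) ^ n * (a ^ m * b ^ (n - m)) := by
  obtain ⟨e, he⟩ := exists_orthonormalBasis_inner_eq_zero W hW
  let v : Fin n → EuclideanSpace ℝ (Fin n) := fun i => WithLp.toLp 2 (G i)
  let Q : Matrix (Fin n) (Fin n) ℝ := Matrix.of fun i j => e j i
  let M : Matrix (Fin n) (Fin n) ℝ := Matrix.of fun i j => inner ℝ (v i) (e j)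
  have hM : M = G * Q := by
    ext i j
    simp [M, Q, v, Matrix.mul_apply, PiLp.inner_apply, mul_comm]
  have hQ : Q.det ^ 2 = 1 := by
    have h1 := (EuclideanSpace.basisFun (Fin n) ℝ).det_to_matrix_orthonormalBasis_real e
    rw [Module.Basis.det_apply] at h1
    have : (EuclideanSpace.basisFun (Fin n) ℝ).toBasis.toMatrix e = Q := by
      ext i j
      simp [Q, Module.Basis.toMatrix_apply]
    rw [this] at h1
    exact sq_eq_one_iff.mpr h1
  have hdet : G.det ^ 2 = M.det ^ 2 := by rw [hM, Matrix.det_mul, mul_pow, hQ, mul_one]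
  let c : Fin n → ℝ := fun j => ∑ i, M i j ^ 2
  let s : Fin n → ℝ := fun j => if (j : ℕ) < m then a else b
  have hs (j) : 0 < s j := by simp only [s]; split_ifs <;> assumption
  have hc (j) : 0 ≤ c j := Finset.sum_nonneg fun i _ => sq_nonneg _
  have hprod : ∏ j, s j = a ^ m * b ^ (n - m) := by
    obtain ⟨k, rfl⟩ := Nat.exists_eq_add_of_le hmn
    simp [Fin.prod_univ_add, s]
  have hsum : ∑ j, c j / s j ≤ 2 := by
    have h1 (j) : c j / s j ≤ c j / a + (∑ i, inner ℝ (v i - h i) (e j) ^ 2) / b := by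
      by_cases hj : (j : ℕ) < m
      · simp only [s, hj, if_true, le_add_iff_nonneg_right]
        positivity
      · have : c j = ∑ i, inner ℝ (v i - h i) (e j) ^ 2 := by
          refine Finset.sum_congr rfl fun i _ => ?_
          rw [inner_sub_left, he _ (hh i) j (not_lt.mp hj), sub_zero]
          rfl
        simp only [s, hj, if_false, ← this, le_add_iff_nonneg_left]
        exact div_nonneg (hc j) ha.le
    have hsq (w : Fin n → EuclideanSpace ℝ (Fin n)) :
        ∑ j, ∑ i, inner ℝ (w i) (e j) ^ 2 = ∑ i, ‖w i‖ ^ 2 := by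
      rw [Finset.sum_comm]
      exact Finset.sum_congr rfl fun i _ => e.sum_sq_inner_left _
    calc ∑ j, c j / s j
        ≤ ∑ j, (c j / a + (∑ i, inner ℝ (v i - h i) (e j) ^ 2) / b) :=
          Finset.sum_le_sum fun j _ => h1 j
      _ = (∑ i, ‖v i‖ ^ 2) / a + (∑ i, ‖v i - h i‖ ^ 2) / b := by
        rw [Finset.sum_add_distrib, ← Finset.sum_div, ← Finset.sum_div, hsq]
        simp only [c, M, Matrix.of_apply, hsq]
      _ ≤ 1 + 1 := add_le_add ((div_le_one ha).mpr hGa) ((div_le_one hb).mpr hGb)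
      _ = 2 := by norm_num
  calc G.det ^ 2 ≤ ∏ j, c j := hdet.trans_le M.det_sq_le_prod_sum_sq
    _ = (∏ j, c j / s j) * ∏ j, s j := by
      rw [← Finset.prod_mul_distrib]
      exact Finset.prod_congr rfl fun j _ => (div_mul_cancel₀ _ (hs j).ne').symm
    _ ≤ (2 / n) ^ n * (a ^ m * b ^ (n - m)) := by
      rw [hprod]
      gcongr
      refine (prod_le_arith_mean_pow hn _ fun j => div_nonneg (hc j) (hs j).le).trans ?_
      have : 0 ≤ ∑ j, c j / s j := Finset.sum_nonneg fun j _ => div_nonneg (hc j) (hs j).le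
      gcongr

/-- If the evaluation matrix of contractive functionals at points `x i` is lower triangular with
diagonal at least `δ`, and the `x i` are within `D` of an `m`-dimensional subspace, then `δ` is
controlled by `D`. -/
lemma pow_le_of_near_subspace {X : Type*} [NormedAddCommGroup X] [NormedSpace ℝ X]
    {n m : ℕ} (hn : 0 < n) (hmn : m ≤ n) (x : Fin n → X) (l : Fin n → X →ₗ[ℝ] ℝ)
    {δ s D : ℝ} (hδ : 0 ≤ δ) (hs : 0 < s) (hD : 0 < D)
    (hl : ∀ j y, |l j y| ≤ ‖y‖) (htri : ∀ i j, i < j → l j (x i) = 0)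
    (hdiag : ∀ i, δ ≤ l i (x i)) (hle : ∀ i j, |l j (x i)| ≤ s)
    (Y : Submodule ℝ X) [FiniteDimensional ℝ Y] (hY : Module.finrank ℝ Y ≤ m)
    (hxY : ∀ i, ∃ y ∈ Y, ‖x i - y‖ ≤ D) :
    δ ^ n ≤ √(2 * n) ^ n * (s ^ m * D ^ (n - m)) := by
  choose y hy hxy using hxY
  let T : X →ₗ[ℝ] EuclideanSpace ℝ (Fin n) :=
    (WithLp.linearEquiv 2 ℝ (Fin n → ℝ)).symm.toLinearMap ∘ₗ LinearMap.pi l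
  have hT (z : X) (j) : T z j = l j z := rfl
  have hnorm {z : X} {r : ℝ} (hz : ∀ j, |l j z| ≤ r) : ‖T z‖ ^ 2 ≤ n * r ^ 2 := by
    rw [EuclideanSpace.norm_sq_eq]
    refine (Finset.sum_le_card_nsmul _ _ (r ^ 2) fun j _ => ?_).trans_eq (by simp)
    rw [hT, Real.norm_eq_abs]
    gcongr
    exact hz j
  let G : Matrix (Fin n) (Fin n) ℝ := Matrix.of fun i j => l j (x i)
  have hG (i) : WithLp.toLp 2 (G i) = T (x i) := rfl
  have hdet : G.det = ∏ i, l i (x i) := Matrix.det_of_isLowerTriangular _ fun i j hij => htri i j hij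
  have hsumle {z : Fin n → X} {r : ℝ} (hz : ∀ i j, |l j (z i)| ≤ r) :
      ∑ i, ‖T (z i)‖ ^ 2 ≤ (n * r) ^ 2 := by
    refine (Finset.sum_le_card_nsmul _ _ _ fun i _ => hnorm (hz i)).trans_eq ?_
    simp
    ring
  have key := G.det_sq_le_of_rows_near_subspace hn hmn (Y.map T)
    ((Submodule.finrank_map_le T Y).trans hY) (fun i => T (y i))
    (fun i => Submodule.mem_map_of_mem (hy i)) (a := (n * s) ^ 2) (b := (n * D) ^ 2)
    (by positivity) (by positivity) (by simpa only [hG] using hsumle hle)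
    (by simpa only [hG, ← map_sub] using hsumle fun i j => (hl j _).trans (hxy i))
  have hδG : δ ^ n ≤ G.det := by
    rw [hdet]
    simpa using Finset.prod_le_prod (s := (Finset.univ : Finset (Fin n))) (f := fun _ => δ)
      (fun _ _ => hδ) fun i _ => hdiag i
  refine abs_le_of_sq_le_sq' ?_ (by positivity) |>.2
  calc (δ ^ n) ^ 2 ≤ G.det ^ 2 := by gcongr
    _ ≤ _ := key
    _ = (√(2 * n) ^ n * (s ^ m * D ^ (n - m))) ^ 2 := by
      obtain ⟨k, rfl⟩ := Nat.exists_eq_add_of_le hmn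
      have : (√(2 * (m + k : ℕ)) ^ (m + k)) ^ 2 = (2 * (m + k : ℕ)) ^ (m + k) := by
        rw [pow_right_comm, Real.sq_sqrt (by positivity)]
      rw [mul_pow (√_ ^ _), this, Nat.add_sub_cancel_left]
      have : ((m + k : ℕ) : ℝ) ≠ 0 := by positivity
      generalize ((m + k : ℕ) : ℝ) = N at *
      rw [div_pow]
      field_simp
      ring

/-- One doubling step for the weak greedy errors. -/
lemma weak_greedy_doubling
    {X : Type*} [NormedAddCommGroup X] [NormedSpace ℝ X]
    {γ : ℝ} (hγ0 : 0 < γ) {F : Set X} (hFb : ∀ g ∈ F, ‖g‖ ≤ 1)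
    {f : ℕ → X} (hfF : ∀ n, f n ∈ F) {σ : ℕ → ℝ}
    (hσle : ∀ n, ∀ g ∈ F, infDist g (span ℝ (f '' Set.Iio n) : Set X) ≤ σ n)
    (hσ0 : ∀ n, 0 ≤ σ n) (hσ : Antitone σ)
    (hgreedy : ∀ n, γ * σ n ≤ infDist (f n) (span ℝ (f '' Set.Iio n) : Set X))
    {n m : ℕ} (hn : 0 < n) (hmn : m ≤ n) {D : ℝ} (hD : 0 < D)
    (hdD : (⨅ Y : {Y : Submodule ℝ X // FiniteDimensional ℝ Y ∧ Module.finrank ℝ Y ≤ m},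
        sSup ((fun g => infDist g ((Y : Submodule ℝ X) : Set X)) '' F)) < D) :
    (γ * σ (2 * n)) ^ n ≤ √(2 * n) ^ n * (σ n ^ m * D ^ (n - m)) := by
  have hbound (V : Submodule ℝ X) (x : X) : infDist x (V : Set X) ≤ ‖x‖ := by
    simpa using infDist_le_dist_of_mem (x := x) V.zero_mem
  rcases (hσ0 n).eq_or_lt with h0 | hpos
  · have : σ (2 * n) = 0 := le_antisymm (h0 ▸ hσ (by lia)) (hσ0 _)
    rw [this, mul_zero, zero_pow hn.ne']
    have := hσ0 n
    positivity
  have : Nonempty {Y : Submodule ℝ X // FiniteDimensional ℝ Y ∧ Module.finrank ℝ Y ≤ m} :=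
    ⟨⊥, inferInstance, by simp⟩
  obtain ⟨⟨Y, hYf, hYm⟩, hYD⟩ := exists_lt_of_ciInf_lt hdD
  choose l hlx hly using fun j : Fin n =>
    exists_linearMap_eq_infDist (span ℝ (f '' Set.Iio (n + j))) (f (n + j))
  refine pow_le_of_near_subspace hn hmn (fun i => f (n + i)) l
    (mul_nonneg hγ0.le (hσ0 _)) hpos hD (fun j y => (hly j y).trans (hbound _ _)) ?_ ?_ ?_ Y hYm ?_
  · intro i j hij
    refine abs_nonpos_iff.mp ((hly j _).trans_eq (infDist_zero_of_mem ?_))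
    exact subset_span (Set.mem_image_of_mem f (by simpa using hij))
  · intro i
    rw [hlx]
    refine le_trans ?_ (hgreedy _)
    gcongr
    exact hσ (by lia)
  · intro i j
    exact ((hly j _).trans (hσle _ _ (hfF _))).trans (hσ (by lia))
  · intro i
    have hbdd : BddAbove ((fun g => infDist g (Y : Set X)) '' F) :=
      ⟨1, by rintro _ ⟨g, hg, rfl⟩; exact (hbound Y g).trans (hFb g hg)⟩
    have hlt : infDist (f (n + i)) (Y : Set X) < D :=
      (le_csSup hbdd (Set.mem_image_of_mem _ (hfF (n + i)))).trans_lt hYD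
    obtain ⟨y, hy, hxy⟩ := (infDist_lt_iff ⟨0, Y.zero_mem⟩).mp hlt
    exact ⟨y, hy, by rw [← dist_eq_norm]; exact hxy.le⟩

/-- An index `m` for which `m / n` is comparable to `2 * β / (2 * β + 1)`, as far as `1 ≤ m`
allows. -/
lemma exists_width_index {β : ℝ} (hβ0 : 0 < β) (hβ : β < 1 / 2) {n : ℕ} (hn : 2 ≤ n) :
    ∃ m : ℕ, 1 ≤ m ∧ 2 * m ≤ n ∧ (n : ℝ) ≤ 2 * ((2 * β + 1) / (2 * β)) * m ∧
      (β + 1 / 2) * m ≤ 1 + β * n := by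
  set B := (2 * β + 1) / (2 * β) with hB
  have hB2 : 2 < B := by rw [hB, lt_div_iff₀ (by positivity)]; linarith
  have hBβ : β + 1 / 2 = β * B := by rw [hB]; field_simp
  have hn' : (2 : ℝ) ≤ n := by exact_mod_cast hn
  rcases lt_or_ge (n : ℝ) B with h | h
  · refine ⟨1, le_rfl, by lia, by simp; linarith, ?_⟩
    push_cast
    nlinarith
  · have h1 : 1 ≤ n / B := by rwa [one_le_div (by linarith)]
    have hfl := Nat.floor_le (a := n / B) (by positivity)
    have hfl' := Nat.lt_floor_add_one (n / B)
    have hm : 1 ≤ ⌊n / B⌋₊ := Nat.le_floor (by simpa using h1)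
    have hm' : (1 : ℝ) ≤ ⌊n / B⌋₊ := by exact_mod_cast hm
    rw [le_div_iff₀ (by linarith)] at hfl
    rw [div_lt_iff₀ (by linarith)] at hfl'
    refine ⟨_, hm, ?_, ?_, ?_⟩
    · have : (2 * ⌊n / B⌋₊ : ℝ) ≤ n := by nlinarith
      exact_mod_cast this
    · nlinarith
    · rw [hBβ]
      nlinarith

/-- The polynomial bound with constant `C₁` survives one doubling step with widths
`C₀ * m ^ (-α)`. -/
lemma width_step_bound {α β γ C₀ C₁ B N : ℝ} (hα : 0 < α) (hβ0 : 0 < β) (hγ0 : 0 < γ)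
    (hγ1 : γ ≤ 1) (hC₀ : 0 < C₀) (hB : 0 < B)
    (hC : C₀ * (4 : ℝ) ^ (4 * α + 1) * γ⁻¹ ^ 4 * B ^ α ≤ C₁)
    {n m : ℕ} (hm : 1 ≤ m) (hmn : 2 * m ≤ n) (hBm : (n : ℝ) ≤ 2 * B * m)
    (hβm : (β + 1 / 2) * m ≤ 1 + β * n) (hN : 2 * n ≤ N) (hN4 : N ≤ 4 * n) :
    √(2 * n) ^ n * ((C₁ * (n : ℝ) ^ (-α + 1 / 2 + β)) ^ m * (C₀ * (m : ℝ) ^ (-α)) ^ (n - m)) ≤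
      (γ * (C₁ * N ^ (-α + 1 / 2 + β))) ^ n := by
  obtain ⟨k, rfl⟩ := Nat.exists_eq_add_of_le (show m ≤ n by lia)
  rw [Nat.add_sub_cancel_left]
  generalize hn : m + k = n at *
  have hm0 : (0 : ℝ) < m := by exact_mod_cast hm
  have hn0 : (0 : ℝ) < n := by exact_mod_cast (by lia : 0 < n)
  have hC₁0 : 0 < C₁ := lt_of_lt_of_le (by positivity) hC
  have hN0 : 0 < N := by linarith
  set u : ℝ := 2 ^ α
  set w : ℝ := γ⁻¹
  set ν : ℝ := (n : ℝ) ^ (-α)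
  set q : ℝ := (n : ℝ) ^ (β + 1 / 2)
  set p : ℝ := (n : ℝ) ^ β
  set r : ℝ := √(2 * n)
  have hu : 1 ≤ u := Real.one_le_rpow (by norm_num) hα.le
  have hw : 1 ≤ w := (one_le_inv₀ hγ0).mpr hγ1
  have hp : 0 < p := by positivity
  have hr : 0 < r := by positivity
  have hν : 0 < ν := by positivity
  have hu4 : (4 : ℝ) ^ α = u ^ 2 := by
    rw [show (4 : ℝ) = 2 ^ 2 by norm_num, ← Real.rpow_pow_comm (by norm_num)]
  have hu16 : (4 : ℝ) ^ (4 * α + 1) = 4 * u ^ 8 := by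
    rw [Real.rpow_add (by norm_num), Real.rpow_one, mul_comm 4 α, Real.rpow_mul (by norm_num), hu4]
    norm_cast
    ring
  rw [hu16] at hC
  have hnpow : (n : ℝ) ^ (-α + 1 / 2 + β) = ν * q := by
    rw [← Real.rpow_add hn0]
    ring_nf
  have hmpow : (m : ℝ) ^ (-α) ≤ u * B ^ α * ν := by
    have h1 : (n : ℝ) / (2 * B) ≤ m := by
      rw [div_le_iff₀ (by positivity)]
      linarith
    calc (m : ℝ) ^ (-α) ≤ (n / (2 * B)) ^ (-α) :=
          Real.rpow_le_rpow_of_nonpos (by positivity) h1 (by linarith)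
      _ = u * B ^ α * ν := by
        rw [Real.div_rpow hn0.le (by positivity), Real.rpow_neg (by positivity : 0 ≤ 2 * B),
          div_inv_eq_mul, Real.mul_rpow (by norm_num) hB.le, mul_comm]
  have hNpow : r * p * ((u ^ 2)⁻¹ * ν) ≤ N ^ (-α + 1 / 2 + β) := by
    have h1 : r * p ≤ N ^ (1 / 2 + β) := by
      rw [Real.rpow_add hN0, ← Real.sqrt_eq_rpow]
      have : (n : ℝ) ≤ N := by linarith
      exact mul_le_mul (Real.sqrt_le_sqrt hN) (Real.rpow_le_rpow hn0.le this hβ0.le) hp.le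
        (by positivity)
    have h2 : (u ^ 2)⁻¹ * ν ≤ N ^ (-α) := by
      rw [← hu4, ← Real.rpow_neg (by norm_num), ← Real.mul_rpow (by norm_num) hn0.le]
      exact Real.rpow_le_rpow_of_nonpos hN0 hN4 (by linarith)
    calc r * p * ((u ^ 2)⁻¹ * ν) ≤ N ^ (1 / 2 + β) * N ^ (-α) := by gcongr
      _ = _ := by
        rw [← Real.rpow_add hN0]
        ring_nf
  have hq : q ^ m ≤ 4 ^ k * p ^ n := by
    calc q ^ m = (n : ℝ) ^ ((β + 1 / 2) * m) := by
          rw [Real.rpow_mul hn0.le, Real.rpow_natCast]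
      _ ≤ (n : ℝ) ^ (1 + β * n) :=
          Real.rpow_le_rpow_of_exponent_le (by exact_mod_cast (by lia : 1 ≤ n)) hβm
      _ = n * p ^ n := by
          rw [Real.rpow_add hn0, Real.rpow_one, Real.rpow_mul hn0.le, Real.rpow_natCast]
      _ ≤ 4 ^ k * p ^ n := by
          gcongr
          have : n ≤ 4 ^ k := calc
            n ≤ 2 ^ n := Nat.lt_two_pow_self.le
            _ ≤ 2 ^ (2 * k) := Nat.pow_le_pow_right (by norm_num) (by lia)
            _ = 4 ^ k := by rw [pow_mul]; norm_num
          exact_mod_cast this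
  have hwu : (w * u ^ 2) ^ n ≤ (w ^ 4 * u ^ 7) ^ k := by
    calc (w * u ^ 2) ^ n ≤ (w * u ^ 2) ^ (2 * k) :=
          pow_le_pow_right₀ (one_le_mul_of_one_le_of_one_le hw (one_le_pow₀ hu)) (by lia)
      _ = (w ^ 2 * u ^ 4) ^ k := by rw [pow_mul]; ring
      _ ≤ (w ^ 4 * u ^ 7) ^ k := by
          gcongr <;> first | assumption | norm_num
  have hcore : q ^ m * (C₀ * (u * B ^ α)) ^ k * (w * u ^ 2) ^ n ≤ C₁ ^ k * p ^ n := by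
    calc q ^ m * (C₀ * (u * B ^ α)) ^ k * (w * u ^ 2) ^ n
        ≤ (4 ^ k * p ^ n) * (C₀ * (u * B ^ α)) ^ k * (w ^ 4 * u ^ 7) ^ k := by gcongr
      _ = (C₀ * (4 * u ^ 8) * w ^ 4 * B ^ α) ^ k * p ^ n := by
        simp only [mul_pow]
        ring
      _ ≤ _ := by gcongr
  have hγw : γ * (w * u ^ 2) * (u ^ 2)⁻¹ = 1 := by
    simp only [w]
    field_simp
  calc r ^ n * ((C₁ * (n : ℝ) ^ (-α + 1 / 2 + β)) ^ m * (C₀ * (m : ℝ) ^ (-α)) ^ k)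
      ≤ r ^ n * ((C₁ * (ν * q)) ^ m * (C₀ * (u * B ^ α * ν)) ^ k) := by
        rw [hnpow]
        gcongr
    _ = r ^ n * C₁ ^ m * ν ^ n * (γ * (u ^ 2)⁻¹) ^ n *
          (q ^ m * (C₀ * (u * B ^ α)) ^ k * (w * u ^ 2) ^ n) := by
        have : (γ * (u ^ 2)⁻¹) ^ n * (w * u ^ 2) ^ n = 1 := by
          rw [← mul_pow, ← one_pow n, ← hγw]
          ring
        calc _ = r ^ n * C₁ ^ m * ν ^ (m + k) * (q ^ m * (C₀ * (u * B ^ α)) ^ k) * 1 := by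
              simp only [mul_pow]
              ring
          _ = _ := by
              rw [hn, ← this]
              ring
    _ ≤ r ^ n * C₁ ^ m * ν ^ n * (γ * (u ^ 2)⁻¹) ^ n * (C₁ ^ k * p ^ n) := by gcongr
    _ = (γ * (C₁ * (r * p * ((u ^ 2)⁻¹ * ν)))) ^ n := by
        have : C₁ ^ n = C₁ ^ m * C₁ ^ k := by rw [← hn, pow_add]
        simp only [mul_pow]
        rw [this]
        ring
    _ ≤ _ := by gcongr

/-- Corollary 4.2 (ii): polynomial decay of widths implies decay `n^{-α+1/2+β}` of greedy errors. -/
theorem weak_greedy_banach_poly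
    {X : Type*} [NormedAddCommGroup X] [NormedSpace ℝ X] [CompleteSpace X]
    (γ : ℝ) (hγ0 : 0 < γ) (hγ1 : γ ≤ 1)
    (F : Set X) (hFc : IsCompact F) (hFb : ∀ g ∈ F, ‖g‖ ≤ 1)
    (f : ℕ → X) (hfF : ∀ n, f n ∈ F)
    (σ : ℕ → ℝ)
    (hσ : ∀ n, σ n =
      sSup ((fun g => infDist g ((span ℝ (f '' Set.Iio n) : Submodule ℝ X) : Set X)) '' F))
    (hgreedy : ∀ n, γ * σ n ≤
      infDist (f n) ((span ℝ (f '' Set.Iio n) : Submodule ℝ X) : Set X))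
    (d : ℕ → ℝ)
    (hd : ∀ m, d m =
      ⨅ Y : {Y : Submodule ℝ X // FiniteDimensional ℝ Y ∧ Module.finrank ℝ Y ≤ m},
        sSup ((fun g => infDist g ((Y : Submodule ℝ X) : Set X)) '' F))
    (α β C₀ : ℝ) (hα : 0 < α) (hC₀ : 0 < C₀) (hβ0 : 0 < β) (hβ : β < min α (1 / 2))
    (hdecay : ∀ n : ℕ, 1 ≤ n → d n ≤ C₀ * (n : ℝ) ^ (-α)) :
    ∀ n : ℕ, 1 ≤ n →
      σ n ≤ max (C₀ * (4 : ℝ) ^ (4 * α + 1) * γ⁻¹ ^ 4 * ((2 * β + 1) / (2 * β)) ^ α)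
          ((Finset.Icc 1 7).sup' (by norm_num) fun k : ℕ => (k : ℝ) ^ (α - β - 1 / 2)) *
        (n : ℝ) ^ (-α + 1 / 2 + β) := by
  have hbound (V : Submodule ℝ X) (g : X) (hg : g ∈ F) : infDist g (V : Set X) ≤ 1 := by
    refine le_trans ?_ (hFb g hg)
    simpa using infDist_le_dist_of_mem (x := g) V.zero_mem
  have hσle (n) (g) (hg : g ∈ F) : infDist g (span ℝ (f '' Set.Iio n) : Set X) ≤ σ n := by
    rw [hσ]
    exact le_csSup ⟨1, by rintro _ ⟨g, hg, rfl⟩; exact hbound _ g hg⟩ ⟨g, hg, rfl⟩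
  have hσ0 (n) : 0 ≤ σ n := infDist_nonneg.trans (hσle n _ (hfF 0))
  have hne (V : Submodule ℝ X) : ((fun g => infDist g (V : Set X)) '' F).Nonempty :=
    ⟨_, f 0, hfF 0, rfl⟩
  have hσ1 (n) : σ n ≤ 1 := by
    rw [hσ]
    refine csSup_le (hne _) ?_
    rintro _ ⟨g, hg, rfl⟩
    exact hbound _ g hg
  have hanti : Antitone σ := by
    intro a b hab
    rw [hσ b]
    refine csSup_le (hne _) ?_
    rintro _ ⟨g, hg, rfl⟩
    refine (infDist_le_infDist_of_subset ?_ ⟨0, zero_mem _⟩).trans (hσle a g hg)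
    exact span_mono (Set.image_mono (Set.Iio_subset_Iio hab))
  obtain ⟨hβα, hβ2⟩ := lt_min_iff.mp hβ
  set B := (2 * β + 1) / (2 * β)
  have hB : 0 < B := by positivity
  set C₁ := max (_ : ℝ) _
  have hAC : C₀ * (4 : ℝ) ^ (4 * α + 1) * γ⁻¹ ^ 4 * B ^ α ≤ C₁ := le_max_left _ _
  have hC₁0 : 0 < C₁ := lt_of_lt_of_le (by positivity) hAC
  intro M
  induction M using Nat.strong_induction_on with
  | _ M ih =>
  intro hM
  have hM0 : (0 : ℝ) < M := by exact_mod_cast hM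
  rcases le_or_gt M 7 with hM7 | hM7
  · refine (hσ1 M).trans ?_
    have h1 : (M : ℝ) ^ (α - β - 1 / 2) ≤ C₁ :=
      (Finset.le_sup' (fun k : ℕ => (k : ℝ) ^ (α - β - 1 / 2))
        (Finset.mem_Icc.mpr ⟨hM, hM7⟩)).trans (le_max_right _ _)
    calc (1 : ℝ) = (M : ℝ) ^ (α - β - 1 / 2) * (M : ℝ) ^ (-α + 1 / 2 + β) := by
          rw [← Real.rpow_add hM0]
          ring_nf
          simp
      _ ≤ _ := by gcongr
  · obtain ⟨n, hn⟩ : ∃ n, n = M / 2 := ⟨_, rfl⟩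
    obtain ⟨m, hm, hmn, hBm, hβm⟩ := exists_width_index hβ0 hβ2 (n := n) (by lia)
    have hn0 : 0 < n := by lia
    have hm0 : (0 : ℝ) < m := by exact_mod_cast hm
    have hd0 : 0 < C₀ * (m : ℝ) ^ (-α) := by positivity
    have hdouble : (γ * σ (2 * n)) ^ n ≤
        √(2 * n) ^ n * (σ n ^ m * (C₀ * (m : ℝ) ^ (-α)) ^ (n - m)) := by
      have hcont : ContinuousWithinAt
          (fun D : ℝ => √(2 * n) ^ n * (σ n ^ m * D ^ (n - m))) (Set.Ioi (C₀ * (m : ℝ) ^ (-α)))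
          (C₀ * (m : ℝ) ^ (-α)) := by fun_prop
      refine ge_of_tendsto hcont ?_
      filter_upwards [self_mem_nhdsWithin] with D hD
      exact weak_greedy_doubling hγ0 hFb hfF hσle hσ0 hanti hgreedy hn0 (by lia) (hd0.trans hD)
        (hd m ▸ (hdecay m hm).trans_lt hD)
    refine (hanti (show 2 * n ≤ M by lia)).trans (le_of_mul_le_mul_left ?_ hγ0)
    refine le_of_pow_le_pow_left₀ hn0.ne' (by positivity) (hdouble.trans ?_)
    refine le_trans ?_ (width_step_bound hα hβ0 hγ0 hγ1 hC₀ hB hAC hm hmn hBm hβm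
      (by exact_mod_cast (by lia : 2 * n ≤ M)) (by exact_mod_cast (by lia : M ≤ 4 * n)))
    have := hσ0 n
    gcongr
    exact ih n (by lia) (by lia)
end
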